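/- Let K be a field, S = K[x_1,…,x_n], let J ⊆ I be squarefree monomial ideals of S generated in degrees ≥ d+1 and ≥ d respectively, and let V ⊆ S be an ideal generated by finitely many squarefree monomials of degrees ≥ d+2 none of which lies in I. If sdepth_S (I+V)/J ≤ d+1, then sdepth_S I/J ≤ d+1. -/

import Mathlib

open MvPolynomial

/-- The squarefree monomial with support `T` in `K[x_0,…,x_{n-1}]`. -/
noncomputable def sqf (K : Type*) [Field K] (n : ℕ) (T : Finset (Fin n)) :
    MvPolynomial (Fin n) K :=
  ∏ i ∈ T, X i

/-- The poset `P_{I\J}`: supports of squarefree monomials lying in `I \ J`. -/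
def sqfPoset (K : Type*) [Field K] (n : ℕ) (I J : Ideal (MvPolynomial (Fin n) K)) :
    Set (Finset (Fin n)) :=
  {T | sqf K n T ∈ I ∧ sqf K n T ∉ J}

/-- Supports of squarefree monomials of degree `d` lying in `I \ J`. -/
def degSet (K : Type*) [Field K] (n : ℕ) (I J : Ideal (MvPolynomial (Fin n) K)) (d : ℕ) :
    Set (Finset (Fin n)) :=
  {T | T.card = d ∧ T ∈ sqfPoset K n I J}

/-- A partition of a set `P` of supports of squarefree monomials into intervals
`[u,v] = {w : u ⊆ w ⊆ v}`. -/
structure SqfPartition (n : ℕ) (P : Set (Finset (Fin n))) where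
  intervals : Finset (Finset (Fin n) × Finset (Fin n))
  le : ∀ p ∈ intervals, p.1 ⊆ p.2
  ends : ∀ p ∈ intervals, p.1 ∈ P ∧ p.2 ∈ P
  covers : ∀ T ∈ P, ∃ p ∈ intervals, p.1 ⊆ T ∧ T ⊆ p.2
  disj : ∀ p ∈ intervals, ∀ q ∈ intervals, ∀ T : Finset (Fin n),
    p.1 ⊆ T → T ⊆ p.2 → q.1 ⊆ T → T ⊆ q.2 → p = q

/-- The Stanley depth of a partition: the minimal degree of the upper ends of
its intervals. -/
noncomputable def SqfPartition.sdepth {n : ℕ} {P : Set (Finset (Fin n))}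
    (pt : SqfPartition n P) : ℕ :=
  sInf {k | ∃ p ∈ pt.intervals, p.2.card = k}

/-- The Stanley depth of `I/J`: the maximal Stanley depth of a partition of `P_{I\J}`. -/
noncomputable def stanleyDepth (K : Type*) [Field K] (n : ℕ)
    (I J : Ideal (MvPolynomial (Fin n) K)) : ℕ :=
  sSup {k | ∃ pt : SqfPartition n (sqfPoset K n I J), pt.sdepth = k}

/-- The `S`-module `I/J` (for `J ⊆ I` this is the usual quotient). -/
noncomputable abbrev quotMod (K : Type*) [Field K] (n : ℕ)
    (I J : Ideal (MvPolynomial (Fin n) K)) : Type _ :=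
  I ⧸ (Submodule.comap I.subtype J)

/-- The depth of `I/J` over `S = K[x_0,…,x_{n-1}]`: the supremum of lengths of
regular sequences on `I/J` consisting of elements of the maximal graded ideal
`(x_0,…,x_{n-1})`. -/
noncomputable def mdepth (K : Type*) [Field K] (n : ℕ)
    (I J : Ideal (MvPolynomial (Fin n) K)) : ℕ :=
  sSup {k | ∃ rs : List (MvPolynomial (Fin n) K), rs.length = k ∧
    (∀ r ∈ rs, r ∈ Ideal.span (Set.range (X : Fin n → MvPolynomial (Fin n) K))) ∧
    RingTheory.Sequence.IsRegular (quotMod K n I J) rs}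

theorem sqf_eq_monomial (K : Type*) [Field K] (n : ℕ) (T : Finset (Fin n)) :
    sqf K n T = monomial (∑ i ∈ T, Finsupp.single i 1) (1 : K) := by
  simp [sqf, monomial_sum_one, X]

theorem sum_single_one_apply {n : ℕ} (T : Finset (Fin n)) (j : Fin n) :
    (∑ i ∈ T, Finsupp.single i 1 : Fin n →₀ ℕ) j = if j ∈ T then 1 else 0 := by
  simp [Finsupp.finsetSum_apply, Finsupp.single_apply]

theorem sum_single_one_le_iff {n : ℕ} (A T : Finset (Fin n)) :
    (∑ i ∈ A, Finsupp.single i 1 : Fin n →₀ ℕ) ≤ ∑ i ∈ T, Finsupp.single i 1 ↔ A ⊆ T := by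
  simp only [Finsupp.le_def, sum_single_one_apply, Finset.subset_iff]
  exact forall_congr' fun j => by split_ifs <;> simp_all

theorem sqf_mem_span_iff (K : Type*) [Field K] (n : ℕ) (G : Set (Finset (Fin n)))
    (T : Finset (Fin n)) :
    sqf K n T ∈ Ideal.span (sqf K n '' G) ↔ ∃ A ∈ G, A ⊆ T := by
  classical
  have himage : sqf K n '' G =
      (fun s => monomial s (1 : K)) '' ((fun A => ∑ i ∈ A, Finsupp.single i 1) '' G) := by
    rw [Set.image_image]
    exact Set.image_congr fun A _ => sqf_eq_monomial K n A
  rw [himage, mem_ideal_span_monomial_image, sqf_eq_monomial, support_monomial]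
  simp [sum_single_one_le_iff]

theorem sqf_mem_of_subset {K : Type*} [Field K] {n : ℕ} {I : Ideal (MvPolynomial (Fin n) K)}
    {A T : Finset (Fin n)} (hAT : A ⊆ T) (hA : sqf K n A ∈ I) : sqf K n T ∈ I :=
  Ideal.mem_of_dvd I (Finset.prod_dvd_prod_of_subset A T _ hAT) hA

namespace SqfPartition

variable {n : ℕ} {P Q : Set (Finset (Fin n))}

theorem sdepth_le_card (pt : SqfPartition n P) {p : Finset (Fin n) × Finset (Fin n)}
    (hp : p ∈ pt.intervals) : pt.sdepth ≤ p.2.card :=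
  Nat.sInf_le ⟨p, hp, rfl⟩

theorem intervals_nonempty_of_sdepth_pos (pt : SqfPartition n P) (h : 0 < pt.sdepth) :
    pt.intervals.Nonempty := by
  obtain ⟨_, p, hp, _⟩ := Nat.nonempty_of_pos_sInf h
  exact ⟨p, hp⟩

theorem le_sdepth (pt : SqfPartition n P) (hne : pt.intervals.Nonempty) {k : ℕ}
    (h : ∀ p ∈ pt.intervals, k ≤ p.2.card) : k ≤ pt.sdepth := by
  obtain ⟨p, hp⟩ := hne
  refine le_csInf ⟨_, p, hp, rfl⟩ ?_
  rintro _ ⟨q, hq, rfl⟩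
  exact h q hq

theorem sdepth_le (pt : SqfPartition n P) : pt.sdepth ≤ n := by
  rcases Nat.eq_zero_or_pos pt.sdepth with h | h
  · omega
  · obtain ⟨p, hp⟩ := pt.intervals_nonempty_of_sdepth_pos h
    exact (pt.sdepth_le_card hp).trans (card_finset_fin_le p.2)

open Classical in
/-- Extend a partition of `P` to a larger poset `Q` by the trivial intervals `[T, T]` for
`T ∈ Q \ P`, provided that no interval of the given partition contains such a `T`. -/
noncomputable def extend (pt : SqfPartition n P) (hPQ : P ⊆ Q)
    (hsep : ∀ p ∈ pt.intervals, ∀ T ∈ Q, p.1 ⊆ T → T ⊆ p.2 → T ∈ P) :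
    SqfPartition n Q where
  intervals := pt.intervals ∪ {T | T ∈ Q ∧ T ∉ P}.toFinset.image fun T => (T, T)
  le p hp := by
    simp only [Finset.mem_union, Finset.mem_image, Set.mem_toFinset, Set.mem_ofPred_eq] at hp
    rcases hp with hp | ⟨T, -, rfl⟩
    · exact pt.le p hp
    · exact subset_rfl
  ends p hp := by
    simp only [Finset.mem_union, Finset.mem_image, Set.mem_toFinset, Set.mem_ofPred_eq] at hp
    rcases hp with hp | ⟨T, hT, rfl⟩
    · exact ⟨hPQ (pt.ends p hp).1, hPQ (pt.ends p hp).2⟩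
    · exact ⟨hT.1, hT.1⟩
  covers T hT := by
    by_cases hTP : T ∈ P
    · obtain ⟨p, hp, h⟩ := pt.covers T hTP
      exact ⟨p, Finset.mem_union_left _ hp, h⟩
    · refine ⟨(T, T), Finset.mem_union_right _ ?_, subset_rfl, subset_rfl⟩
      exact Finset.mem_image_of_mem _ (by simpa using ⟨hT, hTP⟩)
  disj p hp q hq T hp₁ hp₂ hq₁ hq₂ := by
    simp only [Finset.mem_union, Finset.mem_image, Set.mem_toFinset, Set.mem_ofPred_eq] at hp hq
    rcases hp with hp | ⟨A, hA, rfl⟩ <;> rcases hq with hq | ⟨B, hB, rfl⟩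
    · exact pt.disj p hp q hq T hp₁ hp₂ hq₁ hq₂
    · obtain rfl := hq₁.antisymm hq₂
      exact absurd (hsep p hp B hB.1 hp₁ hp₂) hB.2
    · obtain rfl := hp₁.antisymm hp₂
      exact absurd (hsep q hq A hA.1 hq₁ hq₂) hA.2
    · obtain rfl := hp₁.antisymm hp₂
      obtain rfl := hq₁.antisymm hq₂
      rfl

theorem le_sdepth_extend (pt : SqfPartition n P) (hPQ : P ⊆ Q)
    (hsep : ∀ p ∈ pt.intervals, ∀ T ∈ Q, p.1 ⊆ T → T ⊆ p.2 → T ∈ P) {k : ℕ} (hk : 0 < k)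
    (hpt : k ≤ pt.sdepth) (hcard : ∀ T ∈ Q, T ∉ P → k ≤ T.card) :
    k ≤ (pt.extend hPQ hsep).sdepth := by
  classical
  obtain ⟨p, hp⟩ := pt.intervals_nonempty_of_sdepth_pos (hk.trans_le hpt)
  refine le_sdepth _ ⟨p, Finset.mem_union_left _ hp⟩ fun q hq => ?_
  simp only [extend, Finset.mem_union, Finset.mem_image, Set.mem_toFinset,
    Set.mem_ofPred_eq] at hq
  rcases hq with hq | ⟨T, hT, rfl⟩
  · exact hpt.trans (pt.sdepth_le_card hq)
  · exact hcard T hT.1 hT.2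

end SqfPartition

theorem SqfPartition.sdepth_le_stanleyDepth {K : Type*} [Field K] {n : ℕ}
    {I J : Ideal (MvPolynomial (Fin n) K)} (pt : SqfPartition n (sqfPoset K n I J)) :
    pt.sdepth ≤ stanleyDepth K n I J := by
  refine le_csSup ⟨n, ?_⟩ ⟨pt, rfl⟩
  rintro _ ⟨qt, rfl⟩
  exact qt.sdepth_le

/-- **Lemma 1.6** (Stanley depth part). -/
theorem stmt5 (n : ℕ) (K : Type*) [Field K] (d : ℕ)
    (I J V : Ideal (MvPolynomial (Fin n) K))
    (hJI : J ≤ I)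
    (hI : ∃ G : Set (Finset (Fin n)), (∀ T ∈ G, d ≤ T.card) ∧
      I = Ideal.span (sqf K n '' G))
    (hJ : ∃ G : Set (Finset (Fin n)), (∀ T ∈ G, d + 1 ≤ T.card) ∧
      J = Ideal.span (sqf K n '' G))
    (hV : ∃ W : Finset (Finset (Fin n)), (∀ T ∈ W, d + 2 ≤ T.card ∧ sqf K n T ∉ I) ∧
      V = Ideal.span (sqf K n '' (W : Set (Finset (Fin n)))))
    (h : stanleyDepth K n (I + V) J ≤ d + 1) :
    stanleyDepth K n I J ≤ d + 1 := by
  obtain ⟨G, -, hG⟩ := hI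
  obtain ⟨W, hW, hWV⟩ := hV
  refine csSup_le' ?_
  rintro _ ⟨pt, rfl⟩
  by_contra! hlt
  have hPQ : sqfPoset K n I J ⊆ sqfPoset K n (I + V) J :=
    fun T hT => ⟨Submodule.mem_sup_left hT.1, hT.2⟩
  have hsep : ∀ p ∈ pt.intervals, ∀ T ∈ sqfPoset K n (I + V) J, p.1 ⊆ T → T ⊆ p.2 →
      T ∈ sqfPoset K n I J :=
    fun p hp T hT hpT _ => ⟨sqf_mem_of_subset hpT (pt.ends p hp).1.1, hT.2⟩
  have hcard : ∀ T ∈ sqfPoset K n (I + V) J, T ∉ sqfPoset K n I J → d + 2 ≤ T.card := by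
    intro T hT hTI
    have hmem := hT.1
    rw [Submodule.add_eq_sup, hG, hWV, ← Ideal.span_union, ← Set.image_union,
      sqf_mem_span_iff] at hmem
    obtain ⟨A, hA | hA, hAT⟩ := hmem
    · refine absurd ⟨?_, hT.2⟩ hTI
      rw [hG, sqf_mem_span_iff]
      exact ⟨A, hA, hAT⟩
    · exact (hW A hA).1.trans (Finset.card_le_card hAT)
  have hext := pt.le_sdepth_extend hPQ hsep (by omega) hlt hcard
  have := (pt.extend hPQ hsep).sdepth_le_stanleyDepth
  omega
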